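/- The residual layer built from circular convolutions commutes with the discrete Fourier transform: for all x, w_1, w_2 ∈ ℂ^N, F_N( A_N(x ⋆ w_1) ⋆ w_2 + x ) = A_[N]( F_N(x) · F_N(w_1) ) · F_N(w_2) + F_N(x). -/

import Mathlib

open Complex Finset

/-- The discrete Fourier transform `F_N : ℂ^N → ℂ^N`,
`F_N(x)_k = ∑_j x_j ω^{jk}` with `ω = exp(-2πi/N)`. -/
noncomputable def dft (N : ℕ) (x : Fin N → ℂ) : Fin N → ℂ :=
  fun k => ∑ j : Fin N, x j * Complex.exp (-2 * Real.pi * Complex.I / N) ^ ((j : ℕ) * (k : ℕ))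

/-- Circular convolution `(x ⋆ y)_k = ∑_j x_j y_{(k-j) mod N}`. -/
noncomputable def cconv {N : ℕ} (x y : Fin N → ℂ) : Fin N → ℂ :=
  fun k => ∑ j : Fin N, x j * y (k - j)

/-- The Euclidean (Hermitian) norm `‖x‖ = √(∑_j x_j conj(x_j))` on `ℂ^N`. -/
noncomputable def cnorm {N : ℕ} (x : Fin N → ℂ) : ℝ :=
  Real.sqrt (∑ j : Fin N, Complex.normSq (x j))

/-- The spatial-domain activation `A_N(x) = x / (√N ‖x‖)` for `x ≠ 0`, and `A_N(0) = 0`. -/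
noncomputable def actA (N : ℕ) (x : Fin N → ℂ) : Fin N → ℂ :=
  if x = 0 then 0 else fun j => x j / ((Real.sqrt N : ℂ) * (cnorm x : ℂ))

/-- The frequency-domain activation `A_[N](z) = z / ‖z‖` for `z ≠ 0`, and `A_[N](0) = 0`. -/
noncomputable def actAFreq (N : ℕ) (z : Fin N → ℂ) : Fin N → ℂ :=
  if z = 0 then 0 else fun j => z j / (cnorm z : ℂ)

/-- The root of unity `exp (-2πi/N)` in the definition of `dft` is primitive. -/
theorem isPrimitiveRoot_exp_neg {N : ℕ} (hN : 0 < N) :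
    IsPrimitiveRoot (Complex.exp (-2 * Real.pi * Complex.I / N)) N := by
  have h := (Complex.isPrimitiveRoot_exp N hN.ne').inv
  rw [← Complex.exp_neg] at h
  rwa [← neg_div, show -(2 * (Real.pi : ℂ) * Complex.I) = -2 * Real.pi * Complex.I by ring] at h

theorem IsPrimitiveRoot.pow_fin_add_mul {N : ℕ} {ω : ℂ} (hω : IsPrimitiveRoot ω N)
    (a b : Fin N) (k : ℕ) :
    ω ^ (((a + b : Fin N) : ℕ) * k) = ω ^ ((a : ℕ) * k) * ω ^ ((b : ℕ) * k) := by
  have h : ω ^ ((a + b : Fin N) : ℕ) = ω ^ ((a : ℕ) + (b : ℕ)) := by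
    rw [Fin.val_add, ← pow_mod_orderOf ω (a + b), ← hω.eq_orderOf]
  rw [pow_mul, h, pow_add, mul_pow, ← pow_mul, ← pow_mul]

/-- Orthogonality of the characters of `ℤ / N`. -/
theorem IsPrimitiveRoot.sum_pow_mul_conj_pow {N : ℕ} {ω : ℂ} (hN : 0 < N)
    (hω : IsPrimitiveRoot ω N) (i j : Fin N) :
    ∑ k : Fin N, ω ^ ((i : ℕ) * (k : ℕ)) * (starRingEnd ℂ) (ω ^ ((j : ℕ) * (k : ℕ))) =
      if i = j then (N : ℂ) else 0 := by
  have hconj : (starRingEnd ℂ) ω = ω⁻¹ :=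
    (Complex.inv_eq_conj (hω.norm'_eq_one hN.ne')).symm
  have h0 : ω ≠ 0 := hω.ne_zero hN.ne'
  set r : ℂ := ω ^ (i : ℕ) * (ω ^ (j : ℕ))⁻¹ with hr
  have hterm : ∀ k : Fin N,
      ω ^ ((i : ℕ) * (k : ℕ)) * (starRingEnd ℂ) (ω ^ ((j : ℕ) * (k : ℕ))) = r ^ (k : ℕ) := by
    intro k
    rw [map_pow, hconj, hr, mul_pow, pow_mul, pow_mul, inv_pow]
  rw [Finset.sum_congr rfl fun k _ => hterm k, Fin.sum_univ_eq_sum_range (fun k => r ^ k)]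
  split_ifs with hij
  · have hr1 : r = 1 := by rw [hr, hij, mul_inv_cancel₀ (pow_ne_zero _ h0)]
    simp [hr1]
  · have hr1 : r ≠ 1 := by
      intro h
      rw [hr, mul_inv_eq_one₀ (pow_ne_zero _ h0)] at h
      exact hij (Fin.ext (hω.pow_inj i.2 j.2 h))
    have hrN : r ^ N = 1 := by
      rw [hr, mul_pow, inv_pow, pow_right_comm, pow_right_comm ω (j : ℕ), hω.pow_eq_one, one_pow,
        one_pow, inv_one, mul_one]
    rw [geom_sum_eq hr1, hrN, sub_self, zero_div]

theorem dft_add (N : ℕ) (x y : Fin N → ℂ) (k : Fin N) :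
    dft N (fun j => x j + y j) k = dft N x k + dft N y k := by
  simp only [dft, add_mul, Finset.sum_add_distrib]

/-- The convolution theorem for the discrete Fourier transform. -/
theorem dft_cconv {N : ℕ} (hN : 0 < N) (x y : Fin N → ℂ) :
    dft N (cconv x y) = fun k => dft N x k * dft N y k := by
  have : NeZero N := ⟨hN.ne'⟩
  have hω := isPrimitiveRoot_exp_neg hN
  funext k
  simp only [dft, cconv, Finset.sum_mul]
  rw [Finset.sum_comm]
  refine Finset.sum_congr rfl fun j _ => ?_
  rw [← Equiv.sum_comp (Equiv.addLeft j), Finset.mul_sum]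
  refine Finset.sum_congr rfl fun m _ => ?_
  rw [Equiv.coe_addLeft, add_sub_cancel_left, hω.pow_fin_add_mul]
  ring

/-- Parseval's identity for the discrete Fourier transform. -/
theorem sum_normSq_dft {N : ℕ} (hN : 0 < N) (x : Fin N → ℂ) :
    ∑ k, Complex.normSq (dft N x k) = N * ∑ j, Complex.normSq (x j) := by
  have hω := isPrimitiveRoot_exp_neg hN
  apply Complex.ofReal_injective
  push_cast
  simp only [← Complex.mul_conj, dft, map_sum, map_mul, Finset.sum_mul_sum]
  rw [Finset.sum_comm, Finset.mul_sum]
  refine Finset.sum_congr rfl fun i _ => ?_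
  rw [Finset.sum_comm]
  have h : ∀ j : Fin N, ∑ k : Fin N,
      x i * Complex.exp (-2 * Real.pi * Complex.I / N) ^ ((i : ℕ) * (k : ℕ)) *
        ((starRingEnd ℂ) (x j) * (starRingEnd ℂ)
          (Complex.exp (-2 * Real.pi * Complex.I / N) ^ ((j : ℕ) * (k : ℕ)))) =
      x i * (starRingEnd ℂ) (x j) * if i = j then (N : ℂ) else 0 := by
    intro j
    rw [← hω.sum_pow_mul_conj_pow hN i j, Finset.mul_sum]
    exact Finset.sum_congr rfl fun k _ => by ring
  rw [Finset.sum_congr rfl fun j _ => h j]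
  simp [mul_comm]

theorem cnorm_dft {N : ℕ} (hN : 0 < N) (x : Fin N → ℂ) :
    cnorm (dft N x) = Real.sqrt N * cnorm x := by
  rw [cnorm, sum_normSq_dft hN, Real.sqrt_mul (Nat.cast_nonneg N), cnorm]

theorem cnorm_eq_zero {N : ℕ} {x : Fin N → ℂ} : cnorm x = 0 ↔ x = 0 := by
  rw [cnorm, Real.sqrt_eq_zero (Finset.sum_nonneg fun j _ => Complex.normSq_nonneg _),
    Finset.sum_eq_zero_iff_of_nonneg fun j _ => Complex.normSq_nonneg _]
  simp [funext_iff]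

theorem dft_eq_zero {N : ℕ} (hN : 0 < N) {x : Fin N → ℂ} : dft N x = 0 ↔ x = 0 := by
  have h : Real.sqrt N ≠ 0 := (Real.sqrt_pos.2 (Nat.cast_pos.2 hN)).ne'
  rw [← cnorm_eq_zero, cnorm_dft hN, mul_eq_zero, cnorm_eq_zero, or_iff_right h]

theorem dft_actA {N : ℕ} (hN : 0 < N) (x : Fin N → ℂ) :
    dft N (actA N x) = actAFreq N (dft N x) := by
  unfold actA actAFreq
  simp only [dft_eq_zero hN]
  split_ifs with h
  · exact (dft_eq_zero hN).2 rfl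
  · funext k
    rw [cnorm_dft hN, Complex.ofReal_mul]
    simp only [dft, Finset.sum_div]
    exact Finset.sum_congr rfl fun j _ => by ring

/-- the residual layer `R_N(x, w₁, w₂) = A_N(x ⋆ w₁) ⋆ w₂ + x` built
from circular convolutions commutes with the DFT:
`F_N(A_N(x ⋆ w₁) ⋆ w₂ + x) = A_[N](F_N(x) · F_N(w₁)) · F_N(w₂) + F_N(x)`. -/
theorem residual_dft (N : ℕ) (hN : 0 < N) (x w₁ w₂ : Fin N → ℂ) :
    dft N (fun k => cconv (actA N (cconv x w₁)) w₂ k + x k) =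
      fun k => actAFreq N (fun j => dft N x j * dft N w₁ j) k * dft N w₂ k + dft N x k := by
  funext k
  rw [dft_add, dft_cconv hN, dft_actA hN, dft_cconv hN]
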